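/- arXiv:2507.14973 — 2 statements merged into one kernel-verified Lean document; each statement's English description precedes it below -/
import Mathlib

section
/- There exists a compact Hausdorff topological space X that is separable, sequentially compact, and of cardinality exactly 2^𝔭, where 𝔭 is the pseudointersection number. -/
/-- The pseudointersection number `𝔭`: the least cardinality of a family of
infinite subsets of `ℕ` with the strong finite intersection property but with no
infinite pseudointersection. -/
noncomputable def pseudointersectionNumber : Cardinal :=
  sInf {c : Cardinal | ∃ F : Set (Set ℕ), c = Cardinal.mk F ∧
    (∀ f ∈ F, f.Infinite) ∧
    (∀ G : Finset (Set ℕ), ↑G ⊆ F → (⋂₀ (↑G : Set (Set ℕ))).Infinite) ∧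
    ¬ ∃ a : Set ℕ, a.Infinite ∧ ∀ f ∈ F, (a \ f).Finite}

open Set Filter Topology TopologicalSpace

theorem exists_first_difference {I : Type*} [LinearOrder I] [WellFoundedLT I] {f g : I → Bool}
    {i : I} (hi : f i ≠ g i) : ∃ m ≤ i, (∀ j < m, f j = g j) ∧ f m ≠ g m := by
  obtain ⟨m, hm, hmin⟩ := WellFounded.has_min (wellFounded_lt (α := I)) {j | f j ≠ g j} ⟨i, hi⟩
  exact ⟨m, not_lt.1 (hmin i hi), fun l hl => by_contra fun h => hmin l h hl, hm⟩

namespace AlmostTree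

theorem finite_diff_trans {α : Type*} {A B C : Set α} (hAB : (A \ B).Finite)
    (hBC : (B \ C).Finite) : (A \ C).Finite :=
  (hAB.union hBC).subset fun x hx => by
    by_cases hxB : x ∈ B
    · exact Or.inr ⟨hxB, hx.2⟩
    · exact Or.inl ⟨hx.1, hxB⟩

theorem finite_inter_of_finite_diff {α : Type*} {A B C : Set α} (hAB : (A \ B).Finite)
    (hBC : (B ∩ C).Finite) : (A ∩ C).Finite :=
  (hAB.union hBC).subset fun x hx => by
    by_cases hxB : x ∈ B
    · exact Or.inr ⟨hxB, hx.2⟩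
    · exact Or.inl ⟨hx.1, hxB⟩

theorem exists_strictMono_mem {c : ℕ → Set ℕ} (hc : ∀ n, (c n).Infinite) :
    ∃ k : ℕ → ℕ, StrictMono k ∧ ∀ n, k n ∈ c n := by
  choose next hmem hlt using fun n m => (hc n).exists_gt m
  let k : ℕ → ℕ := fun n => Nat.rec (next 0 0) (fun n m => next (n + 1) m) n
  refine ⟨k, strictMono_nat_of_lt_succ fun n => hlt (n + 1) (k n), fun n => ?_⟩
  cases n with
  | zero => exact hmem 0 0
  | succ n => exact hmem (n + 1) (k n)

end AlmostTree

/-- A family of sets of naturals indexed by the nodes `f|≤i` of the binary tree `2 ^ I`, almost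
decreasing along branches and almost disjoint at incompatible nodes. -/
structure IsAlmostTree {I : Type*} [LinearOrder I] (B : (I → Bool) → I → Set ℕ) : Prop where
  diff_finite_of_lt : ∀ f i j, j < i → (B f i \ B f j).Finite
  congr : ∀ f g i, (∀ j ≤ i, f j = g j) → B f i = B g i
  inter_finite_of_split : ∀ f g i, (∀ j < i, f j = g j) → f i ≠ g i → (B f i ∩ B g i).Finite

namespace IsAlmostTree

open AlmostTree

variable {I : Type*} [LinearOrder I] {B : (I → Bool) → I → Set ℕ}

theorem diff_finite (hB : IsAlmostTree B) (f : I → Bool) {i j : I} (h : j ≤ i) :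
    (B f i \ B f j).Finite := by
  rcases h.eq_or_lt with rfl | h
  · simp
  · exact hB.diff_finite_of_lt f i j h

theorem inter_finite [WellFoundedLT I] (hB : IsAlmostTree B) {f g : I → Bool} {i j k : I}
    (hi : j ≤ i) (hk : j ≤ k) (hne : f j ≠ g j) : (B f i ∩ B g k).Finite := by
  obtain ⟨m, hmj, hlt, hm⟩ := exists_first_difference hne
  have hfg : (B f m ∩ B g m).Finite := hB.inter_finite_of_split f g m hlt hm
  have h1 := finite_inter_of_finite_diff (hB.diff_finite f (hmj.trans hi)) hfg
  rw [inter_comm] at h1 ⊢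
  exact finite_inter_of_finite_diff (hB.diff_finite g (hmj.trans hk)) h1

/-- A set that follows a branch on the lower set `D` and is almost disjoint from all nodes
beyond `D` is not split by the tree. -/
theorem not_split_of_follows [WellFoundedLT I] (hB : IsAlmostTree B) {D : Set I}
    (hD : IsLowerSet D) {f : I → Bool} {c : Set ℕ} (h1 : ∀ j ∈ D, (c \ B f j).Finite)
    (h2 : ∀ k ∉ D, ∀ g : I → Bool, (∀ j ∈ D, g j = f j) → (c ∩ B g k).Finite)
    (g : I → Bool) (k : I) : (c \ B g k).Finite ∨ (c ∩ B g k).Finite := by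
  by_cases hag : ∀ j ∈ D, j ≤ k → g j = f j
  · by_cases hk : k ∈ D
    · left
      rw [hB.congr g f k fun j hj => hag j (hD hj hk) hj]
      exact h1 k hk
    · right
      exact h2 k hk g fun j hj => hag j hj (le_of_not_ge fun h => hk (hD h hj))
  · push Not at hag
    obtain ⟨j, hj, hjk, hne⟩ := hag
    exact Or.inr (finite_inter_of_finite_diff (h1 j hj) (hB.inter_finite le_rfl hjk hne.symm))

theorem exists_infinite_not_split [WellFoundedLT I] (hB : IsAlmostTree B) :
    ∃ c : Set ℕ, c.Infinite ∧ ∀ g k, (c \ B g k).Finite ∨ (c ∩ B g k).Finite := by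
  by_contra! hs
  have hmin : ∀ b : {b : Set ℕ // b.Infinite}, ∃ (f : I → Bool) (i : I),
      (b.1 \ B f i).Infinite ∧ (b.1 ∩ B f i).Infinite ∧ ∀ j < i, (b.1 \ B f j).Finite := by
    rintro ⟨b, hb⟩
    obtain ⟨f₀, i₀, h₀⟩ := hs b hb
    obtain ⟨i, ⟨f, hf1, hf2⟩, hi⟩ := WellFounded.has_min (wellFounded_lt (α := I))
      {i | ∃ f, (b \ B f i).Infinite ∧ (b ∩ B f i).Infinite} ⟨i₀, f₀, h₀⟩
    refine ⟨f, i, hf1, hf2, fun j hj => by_contra fun hinf => hi j ⟨f, hinf, ?_⟩ hj⟩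
    intro hfin
    refine hf2 ?_
    rw [inter_comm] at hfin ⊢
    exact finite_inter_of_finite_diff (hB.diff_finite f hj.le) hfin
  choose F J hdiff hinter hbelow using hmin
  let step : {b : Set ℕ // b.Infinite} → {b : Set ℕ // b.Infinite} :=
    fun b => ⟨b.1 ∩ B (F b) (J b), hinter b⟩
  let s : ℕ → {b : Set ℕ // b.Infinite} := fun n => step^[n] ⟨univ, infinite_univ⟩
  have hs_succ : ∀ n, (s (n + 1)).1 = (s n).1 ∩ B (F (s n)) (J (s n)) := fun n => by
    simp only [s, Function.iterate_succ_apply', step]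
  have hanti : Antitone fun n => (s n).1 := antitone_nat_of_succ_le fun n => by
    simp only [hs_succ]
    exact inter_subset_left
  have hsub : ∀ n, (s (n + 1)).1 ⊆ B (F (s n)) (J (s n)) := fun n => by
    rw [hs_succ]
    exact inter_subset_right
  have hfollow : ∀ n, ∀ j ≤ J (s n), ((s (n + 1)).1 \ B (F (s n)) j).Finite := fun n j hj =>
    (hB.diff_finite _ hj).subset (sdiff_subset_sdiff_left (hsub n))
  have hagree : ∀ n, ∀ j, j ≤ J (s n) → j ≤ J (s (n + 1)) → F (s (n + 1)) j = F (s n) j := by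
    intro n j hj hj'
    by_contra hne
    exact hinter (s (n + 1)) (finite_inter_of_finite_diff (hfollow n j hj)
      (hB.inter_finite le_rfl hj' (Ne.symm hne)))
  have hJ : StrictMono fun n => J (s n) := strictMono_nat_of_lt_succ fun n => by
    by_contra hle
    rw [not_lt] at hle
    refine hdiff (s (n + 1)) ?_
    rw [hB.congr _ (F (s n)) _ fun j hj => hagree n j (hj.trans hle) hj]
    exact hfollow n _ hle
  have hagree' : ∀ n m, n ≤ m → ∀ j ≤ J (s n), F (s m) j = F (s n) j := by
    intro n m hnm
    induction m, hnm using Nat.le_induction with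
    | base => exact fun j _ => rfl
    | succ m hnm ih =>
      intro j hj
      have hjm := hj.trans (hJ.monotone hnm)
      rw [← ih j hj]
      exact hagree m j hjm (hjm.trans (hJ m.lt_succ_self).le)
  let D : Set I := {j | ∃ n, j < J (s n)}
  have hD : IsLowerSet D := fun a b hba ⟨n, hn⟩ => ⟨n, hba.trans_lt hn⟩
  have hJD : ∀ n, J (s n) ∈ D := fun n => ⟨n + 1, hJ n.lt_succ_self⟩
  obtain ⟨f, hf⟩ : ∃ f : I → Bool, ∀ n, ∀ j ≤ J (s n), f j = F (s n) j := by
    classical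
    refine ⟨fun j => if h : ∃ n, j ≤ J (s n) then F (s (Nat.find h)) j else false, ?_⟩
    intro n j hj
    have h : ∃ n, j ≤ J (s n) := ⟨n, hj⟩
    simp only [dif_pos h]
    exact (hagree' _ _ (Nat.find_min' h hj) j (Nat.find_spec h)).symm
  have hnode : ∀ n, ∀ g : I → Bool, (∀ j ∈ D, g j = f j) → ∀ k ∉ D,
      (((s n).1 \ (s (n + 1)).1) ∩ B g k).Finite := by
    intro n g hg k hk
    have hle : J (s n) ≤ k := le_of_not_gt fun h => hk ⟨n, h⟩
    refine (hB.diff_finite g hle).subset fun x hx => ⟨hx.2, fun hxB => hx.1.2 ?_⟩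
    rw [hB.congr g (F (s n)) _ fun j hj => (hg j (hD hj (hJD n))).trans (hf n j hj)] at hxB
    rw [hs_succ]
    exact ⟨hx.1.1, hxB⟩
  obtain ⟨E, hE1, hE2⟩ : ∃ E : Set ℕ, (∀ n, (((s n).1 \ (s (n + 1)).1) ∩ E).Finite) ∧
      ∀ k ∉ D, ∀ g : I → Bool, (∀ j ∈ D, g j = f j) → (B g k \ E).Finite := by
    by_cases hne : (Dᶜ).Nonempty
    · obtain ⟨l, hl, hlmin⟩ := WellFounded.has_min (wellFounded_lt (α := I)) Dᶜ hne
      have hlt : ∀ j < l, j ∈ D := fun j hj => by_contra fun h => hlmin j h hj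
      have hup : ∀ b, ∀ j ∈ D, Function.update f l b j = f j := fun b j hj =>
        Function.update_of_ne (fun h : j = l => hl (h ▸ hj)) _ _
      refine ⟨⋃ b, B (Function.update f l b) l, fun n => ?_, fun k hk g hg => ?_⟩
      · rw [inter_iUnion]
        exact finite_iUnion fun b => hnode n _ (hup b) l hl
      · have hlk : l ≤ k := le_of_not_gt fun h => hk (hlt k h)
        refine (hB.diff_finite g hlk).subset (sdiff_subset_sdiff_right ?_)
        rw [hB.congr g (Function.update f l (g l)) l]
        · exact subset_iUnion (fun b => B (Function.update f l b) l) (g l)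
        · intro j hj
          rcases hj.eq_or_lt with rfl | hj
          · simp
          · rw [hup _ j (hlt j hj), hg j (hlt j hj)]
    · refine ⟨∅, by simp, fun k hk => (hne ⟨k, hk⟩).elim⟩
  have hdiff' : ∀ n, (((s n).1 \ (s (n + 1)).1) \ E).Infinite := by
    intro n hfin
    refine hdiff (s n) (((hE1 n).union hfin).subset fun x hx => ?_)
    have hx' : x ∈ (s n).1 \ (s (n + 1)).1 := by
      rw [hs_succ]
      exact ⟨hx.1, fun h => hx.2 h.2⟩
    by_cases hxE : x ∈ E
    · exact Or.inl ⟨hx', hxE⟩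
    · exact Or.inr ⟨hx', hxE⟩
  obtain ⟨k, hk, hkmem⟩ := exists_strictMono_mem hdiff'
  have hrange : ∀ n, (range k \ (s n).1).Finite := fun n =>
    ((finite_lt_nat n).image k).subset <| by
      rintro _ ⟨⟨m, rfl⟩, hm⟩
      exact ⟨m, not_le.1 fun h => hm (hanti h (hkmem m).1.1), rfl⟩
  obtain ⟨g, i, h1, h2⟩ := hs (range k) (infinite_range_of_injective hk.injective)
  refine (hB.not_split_of_follows hD (f := f) ?_ ?_ g i).elim h1 h2
  · rintro j ⟨n, hn⟩
    rw [hB.congr f (F (s n)) j fun l hl => hf n l (hl.trans hn.le)]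
    exact finite_diff_trans (hrange (n + 1)) (hfollow n j hn.le)
  · intro i hi g hg
    refine (hE2 i hi g hg).subset ?_
    rintro _ ⟨⟨m, rfl⟩, hm⟩
    exact ⟨hm, (hkmem m).2⟩

end IsAlmostTree

section Cardinal

open Cardinal

theorem exists_pseudointersection_of_mk_lt {F : Set (Set ℕ)} (hF : #F < pseudointersectionNumber)
    (hfip : ∀ G : Finset (Set ℕ), ↑G ⊆ F → (⋂₀ (↑G : Set (Set ℕ))).Infinite) :
    ∃ a : Set ℕ, a.Infinite ∧ ∀ f ∈ F, (a \ f).Finite := by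
  by_contra h
  refine notMem_of_lt_csInf' hF ⟨F, rfl, fun f hf => ?_, hfip, h⟩
  simpa using hfip {f} (by simpa using hf)

theorem Set.Infinite.exists_halves {A : Set ℕ} (hA : A.Infinite) :
    ∃ h : Bool → Set ℕ, (∀ b, (h b).Infinite) ∧ (∀ b, h b ⊆ A) ∧
      ∀ b c, b ≠ c → h b ∩ h c = ∅ := by
  obtain ⟨t, u, htu, hdisj, hcard⟩ := hA.exists_union_disjoint_cardinal_eq_of_infinite
  have ht_iff : t.Infinite ↔ u.Infinite := by
    rw [← infinite_coe_iff, ← infinite_coe_iff, infinite_iff, infinite_iff, hcard]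
  have hor : t.Infinite ∨ u.Infinite := infinite_union.1 (htu ▸ hA)
  have ht : t.Infinite := hor.elim id ht_iff.2
  have hdisj' := disjoint_iff_inter_eq_empty.1 hdisj
  refine ⟨fun b => cond b t u, ?_, ?_, ?_⟩
  · rintro (_ | _)
    exacts [ht_iff.1 ht, ht]
  · rintro (_ | _)
    exacts [htu ▸ subset_union_right, htu ▸ subset_union_left]
  · rintro (_ | _) (_ | _) h
    exacts [(h rfl).elim, inter_comm t u ▸ hdisj', hdisj', (h rfl).elim]

theorem exists_family_without_pseudointersection : ∃ F : Set (Set ℕ), (∀ f ∈ F, f.Infinite) ∧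
    (∀ G : Finset (Set ℕ), ↑G ⊆ F → (⋂₀ (↑G : Set (Set ℕ))).Infinite) ∧
    ¬ ∃ a : Set ℕ, a.Infinite ∧ ∀ f ∈ F, (a \ f).Finite := by
  have hinf : ∀ s ∈ hyperfilter ℕ, s.Infinite := fun s hs hfin =>
    notMem_hyperfilter_of_finite hfin hs
  refine ⟨{s | s ∈ hyperfilter ℕ}, hinf, fun G hG => hinf _ ?_, ?_⟩
  · exact (Filter.sInter_mem G.finite_toSet).2 hG
  · rintro ⟨a, ha, hsub⟩
    obtain ⟨h, hi, hs, hd⟩ := ha.exists_halves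
    rcases (hyperfilter ℕ).mem_or_compl_mem (h true) with hm | hm
    · refine hi false ((hsub _ hm).subset fun x hx => ⟨hs _ hx, fun hx' => ?_⟩)
      exact (hd false true (by simp)).subset ⟨hx, hx'⟩
    · exact hi true ((hsub _ hm).subset fun x hx => ⟨hs _ hx, fun hx' => hx' hx⟩)

theorem aleph0_le_pseudointersectionNumber : ℵ₀ ≤ pseudointersectionNumber := by
  obtain ⟨F₀, hF₀⟩ := exists_family_without_pseudointersection
  refine le_csInf ⟨_, F₀, rfl, hF₀⟩ ?_
  rintro _ ⟨F, rfl, -, hfip, hno⟩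
  by_contra! hlt
  have hfin : F.Finite := lt_aleph0_iff_set_finite.1 hlt
  refine hno ⟨⋂₀ F, by simpa using hfip hfin.toFinset (by simp), fun f hf => ?_⟩
  rw [sdiff_eq_empty.2 (sInter_subset_of_mem hf)]
  exact finite_empty

theorem infinite_biInter_of_almost_decreasing {I : Type*} [LinearOrder I] {C : I → Set ℕ}
    (u : Finset I) (hinf : ∀ i ∈ u, (C i).Infinite)
    (hdec : ∀ i ∈ u, ∀ j < i, (C i \ C j).Finite) : (⋂ i ∈ u, C i).Infinite := by
  rcases u.eq_empty_or_nonempty with rfl | hu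
  · simpa using infinite_univ
  · have hm := u.max'_mem hu
    have hfin : (⋃ j ∈ u, C (u.max' hu) \ C j).Finite := by
      refine u.finite_toSet.biUnion fun j hj => ?_
      rcases (u.le_max' j hj).eq_or_lt with h | h
      · simp [← h]
      · exact hdec _ hm j h
    refine ((hinf _ hm).sdiff hfin).mono fun x hx => mem_iInter₂.2 fun j hj => by_contra fun h => ?_
    exact hx.2 (mem_iUnion₂.2 ⟨j, hj, hx.1, h⟩)

/-- Below height `𝔭` one can build a full binary tree of infinite sets of naturals. -/
theorem exists_binary_tree {I : Type} [LinearOrder I] [WellFoundedLT I]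
    (hI : ∀ i : I, #(Iio i) < pseudointersectionNumber) :
    ∃ H : (I → Bool) → I → Set ℕ, (∀ f i, (H f i).Infinite) ∧
      (∀ f i j, j < i → (H f i \ H f j).Finite) ∧
      (∀ f g i, (∀ j ≤ i, f j = g j) → H f i = H g i) ∧
      ∀ f g i, (∀ j < i, f j = g j) → f i ≠ g i → H f i ∩ H g i = ∅ := by
  classical
  choose half half_inf half_sub half_disj using
    fun A : {A : Set ℕ // A.Infinite} => A.2.exists_halves
  have hpick : ∀ F : Set (Set ℕ), ∃ a : {A : Set ℕ // A.Infinite},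
      (∃ b : Set ℕ, b.Infinite ∧ ∀ f ∈ F, (b \ f).Finite) → ∀ f ∈ F, (a.1 \ f).Finite := by
    intro F
    by_cases h : ∃ b : Set ℕ, b.Infinite ∧ ∀ f ∈ F, (b \ f).Finite
    · obtain ⟨b, hb, hbF⟩ := h
      exact ⟨⟨b, hb⟩, fun _ => hbF⟩
    · exact ⟨⟨univ, infinite_univ⟩, fun h' => (h h').elim⟩
  choose pick pick_spec using hpick
  let H : (I → Bool) → I → Set ℕ := fun f => WellFoundedLT.fix fun i ih =>
    half (pick (range fun j : Iio i => ih j.1 j.2)) (f i)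
  have H_eq : ∀ f i, H f i = half (pick (range fun j : Iio i => H f j.1)) (f i) := fun f i =>
    WellFoundedLT.fix_eq _ i
  have hinf : ∀ f i, (H f i).Infinite := fun f i => by
    rw [H_eq]
    exact half_inf _ _
  have hcongr : ∀ f g i, (∀ j < i, f j = g j) →
      (range fun j : Iio i => H f j.1) = range fun j : Iio i => H g j.1 := by
    intro f g i
    induction i using WellFoundedLT.induction with
    | ind i ih =>
      intro h
      congr 1
      funext ⟨j, hj⟩
      change H f j = H g j
      rw [H_eq f, H_eq g, h j hj, ih j hj fun l hl => h l (hl.trans hj)]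
  refine ⟨H, hinf, ?_, ?_, ?_⟩
  · intro f i
    induction i using WellFoundedLT.induction with
    | ind i ih =>
      intro j hj
      have hex : ∃ b : Set ℕ, b.Infinite ∧
          ∀ A ∈ range (fun j : Iio i => H f j.1), (b \ A).Finite := by
        refine exists_pseudointersection_of_mk_lt (mk_range_le.trans_lt (hI i)) fun G hG => ?_
        rw [← image_univ] at hG
        obtain ⟨u, -, rfl⟩ := Finset.subset_set_image_iff.1 hG
        have := infinite_biInter_of_almost_decreasing (C := fun j : Iio i => H f j.1) u
          (fun k _ => hinf f k.1) (fun k _ l hl => ih k.1 k.2 l.1 hl)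
        simpa using this
      refine (pick_spec _ hex (H f j) ⟨⟨j, hj⟩, rfl⟩).subset ?_
      rw [H_eq f i]
      exact sdiff_subset_sdiff_left (half_sub _ _)
  · intro f g i h
    rw [H_eq f, H_eq g, h i le_rfl, hcongr f g i fun j hj => h j hj.le]
  · intro f g i h hne
    rw [H_eq f, H_eq g, hcongr f g i h]
    exact half_disj _ _ _ hne

end Cardinal

section Space

open Cardinal

variable {I : Type} {H : (I → Bool) → I → Set ℕ}

/-- The point of the Cantor cube recording which sets of the family `H` contain `n`. -/
noncomputable def memberPoint (H : (I → Bool) → I → Set ℕ) (n : ℕ) : (I → Bool) × I → Bool :=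
  open Classical in fun s => decide (n ∈ H s.1 s.2)

/-- The closure in the Cantor cube of the countable set of all `memberPoint H n`. -/
def treeSpace (H : (I → Bool) → I → Set ℕ) : Set ((I → Bool) × I → Bool) :=
  closure (range (memberPoint H))

@[simp]
theorem memberPoint_eq_true {n : ℕ} {s : (I → Bool) × I} :
    memberPoint H n s = true ↔ n ∈ H s.1 s.2 := by
  simp [memberPoint]

theorem memberPoint_mem_treeSpace (n : ℕ) : memberPoint H n ∈ treeSpace H :=
  subset_closure (mem_range_self n)

theorem isClosed_treeSpace : IsClosed (treeSpace H) := isClosed_closure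

theorem treeSpace_subset {C : Set ((I → Bool) × I → Bool)} (hC : IsClosed C)
    (h : ∀ n, memberPoint H n ∈ C) : treeSpace H ⊆ C :=
  closure_minimal (range_subset_iff.2 h) hC

theorem mem_image_of_finite_diff {x : (I → Bool) × I → Bool} (hx : x ∈ treeSpace H)
    {s t : (I → Bool) × I} (hfin : (H s.1 s.2 \ H t.1 t.2).Finite) (hs : x s = true)
    (ht : x t = false) : x ∈ memberPoint H '' (H s.1 s.2 \ H t.1 t.2) := by
  have hclosed : IsClosed ({y : (I → Bool) × I → Bool | y s = false} ∪ {y | y t = true} ∪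
      memberPoint H '' (H s.1 s.2 \ H t.1 t.2)) :=
    ((isClosed_eq (continuous_apply s) continuous_const).union
      (isClosed_eq (continuous_apply t) continuous_const)).union (hfin.image _).isClosed
  have hmem := treeSpace_subset hclosed (fun n => ?_) hx
  · simpa [hs, ht] using hmem
  · by_cases h1 : n ∈ H s.1 s.2
    · by_cases h2 : n ∈ H t.1 t.2
      · exact Or.inl (Or.inr (memberPoint_eq_true.2 h2))
      · exact Or.inr ⟨n, ⟨h1, h2⟩, rfl⟩
    · refine Or.inl (Or.inl ?_)
      rw [mem_ofPred_eq, ← Bool.not_eq_true, memberPoint_eq_true]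
      exact h1

theorem eq_of_node_eq {x : (I → Bool) × I → Bool} (hx : x ∈ treeSpace H)
    {s t : (I → Bool) × I} (hst : H s.1 s.2 = H t.1 t.2) : x s = x t := by
  refine treeSpace_subset (C := {y | y s = y t})
    (isClosed_eq (continuous_apply s) (continuous_apply t)) (fun n => ?_) hx
  rw [mem_ofPred_eq, Bool.eq_iff_iff, memberPoint_eq_true, memberPoint_eq_true, hst]

theorem not_both_of_disjoint {x : (I → Bool) × I → Bool} (hx : x ∈ treeSpace H)
    {s t : (I → Bool) × I} (hst : H s.1 s.2 ∩ H t.1 t.2 = ∅) : ¬ (x s = true ∧ x t = true) := by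
  have hclosed : IsClosed ({y : (I → Bool) × I → Bool | y s = false} ∪ {y | y t = false}) :=
    (isClosed_eq (continuous_apply s) continuous_const).union
      (isClosed_eq (continuous_apply t) continuous_const)
  have hmem := treeSpace_subset hclosed (fun n => ?_) hx
  · rintro ⟨h1, h2⟩
    simp [h1, h2] at hmem
  · by_contra h
    simp only [mem_union, mem_ofPred_eq, not_or, Bool.not_eq_false, memberPoint_eq_true] at h
    exact hst.subset h

theorem separableSpace_treeSpace : SeparableSpace (treeSpace H) := by
  refine ⟨⟨range fun n => ⟨memberPoint H n, memberPoint_mem_treeSpace n⟩, countable_range _, ?_⟩⟩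
  rw [Subtype.dense_iff, ← range_comp]
  exact subset_rfl

theorem exists_mem_treeSpace_of_branch [LinearOrder I] (hinf : ∀ f i, (H f i).Infinite)
    (hdec : ∀ f i j, j < i → (H f i \ H f j).Finite) (f : I → Bool) :
    ∃ x ∈ treeSpace H, ∀ i, x (f, i) = true := by
  obtain ⟨x, hx, hxi⟩ := (isClosed_treeSpace (H := H)).isCompact.inter_iInter_nonempty
    (fun i => {x | x (f, i) = true})
    (fun i => isClosed_eq (continuous_apply _) continuous_const) fun u => by
      obtain ⟨n, hn⟩ := (infinite_biInter_of_almost_decreasing u (fun i _ => hinf f i)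
        (fun i _ j hj => hdec f i j hj)).nonempty
      rw [mem_iInter₂] at hn
      exact ⟨memberPoint H n, memberPoint_mem_treeSpace n,
        mem_iInter₂.2 fun i hi => memberPoint_eq_true.2 (hn i hi)⟩
  exact ⟨x, hx, fun i => mem_iInter.1 hxi i⟩

theorem two_power_le_mk_treeSpace [LinearOrder I] [WellFoundedLT I]
    (hinf : ∀ f i, (H f i).Infinite)
    (hdec : ∀ f i j, j < i → (H f i \ H f j).Finite)
    (hdisj : ∀ f g i, (∀ j < i, f j = g j) → f i ≠ g i → H f i ∩ H g i = ∅) :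
    2 ^ #I ≤ #(treeSpace H) := by
  choose x hx hxi using exists_mem_treeSpace_of_branch hinf hdec
  have hinj : Function.Injective fun f => (⟨x f, hx f⟩ : treeSpace H) := by
    intro f g hfg
    have hfg' : x f = x g := congrArg Subtype.val hfg
    by_contra hne
    obtain ⟨i, hi⟩ := Function.ne_iff.1 hne
    obtain ⟨m, -, hlt, hm⟩ := exists_first_difference hi
    exact not_both_of_disjoint (hx f) (s := (f, m)) (t := (g, m)) (hdisj f g m hlt hm)
      ⟨hxi f m, hfg' ▸ hxi g m⟩
  simpa using mk_le_of_injective hinj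

/-- The point of the Cantor cube determined by the branch `p.2` cut off at `p.1`. -/
noncomputable def branchPoint [LinearOrder I] (p : Set I × (I → Bool)) : (I → Bool) × I → Bool :=
  open Classical in fun s => decide (s.2 ∈ p.1 ∧ ∀ j ≤ s.2, s.1 j = p.2 j)

theorem treeSpace_subset_union_range [LinearOrder I] [WellFoundedLT I]
    (hdec : ∀ f i j, j < i → (H f i \ H f j).Finite)
    (hcongr : ∀ f g i, (∀ j ≤ i, f j = g j) → H f i = H g i)
    (hdisj : ∀ f g i, (∀ j < i, f j = g j) → f i ≠ g i → H f i ∩ H g i = ∅) :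
    treeSpace H ⊆ range (memberPoint H) ∪ range branchPoint := by
  classical
  intro x hx
  by_cases hr : x ∈ range (memberPoint H)
  · exact Or.inl hr
  have hdown : ∀ f i j, j ≤ i → x (f, i) = true → x (f, j) = true := by
    intro f i j hj hi
    rcases hj.eq_or_lt with rfl | hj
    · exact hi
    by_contra h
    exact hr (image_subset_range _ _ (mem_image_of_finite_diff hx (s := (f, i)) (t := (f, j))
      (hdec f i j hj) hi (Bool.not_eq_true _ ▸ h)))
  have huniq : ∀ f g i j k, i ≤ j → i ≤ k → x (f, j) = true → x (g, k) = true → f i = g i := by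
    intro f g i j k hij hik hf hg
    by_contra hne
    obtain ⟨m, hmi, hlt, hm⟩ := exists_first_difference hne
    exact not_both_of_disjoint hx (s := (f, m)) (t := (g, m)) (hdisj f g m hlt hm)
      ⟨hdown f j m (hmi.trans hij) hf, hdown g k m (hmi.trans hik) hg⟩
  let p : Set I × (I → Bool) := ({i | ∃ f, x (f, i) = true},
    fun i => if h : ∃ f, x (f, i) = true then h.choose i else false)
  have hp : ∀ f i, x (f, i) = true → ∀ j ≤ i, f j = p.2 j := by
    intro f i hf j hj
    have h : ∃ f, x (f, j) = true := ⟨f, hdown f i j hj hf⟩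
    simp only [p, dif_pos h]
    exact huniq _ _ j i j hj le_rfl hf h.choose_spec
  refine Or.inr ⟨p, funext fun ⟨f, i⟩ => ?_⟩
  rw [Bool.eq_iff_iff, branchPoint, decide_eq_true_iff]
  constructor
  · rintro ⟨⟨g, hg⟩, hf⟩
    rw [← hg]
    exact eq_of_node_eq hx (s := (f, i)) (t := (g, i))
      (hcongr f g i fun j hj => (hf j hj).trans (hp g i hg j hj).symm)
  · exact fun hf => ⟨⟨f, hf⟩, hp f i hf⟩

theorem mk_treeSpace_le [LinearOrder I] [WellFoundedLT I] (hI : ℵ₀ ≤ #I)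
    (hdec : ∀ f i j, j < i → (H f i \ H f j).Finite)
    (hcongr : ∀ f g i, (∀ j ≤ i, f j = g j) → H f i = H g i)
    (hdisj : ∀ f g i, (∀ j < i, f j = g j) → f i ≠ g i → H f i ∩ H g i = ∅) :
    #(treeSpace H) ≤ 2 ^ #I := by
  have hle : ℵ₀ ≤ 2 ^ #I := hI.trans (cantor _).le
  have h1 : #(range (memberPoint H)) ≤ 2 ^ #I := (mk_range_le (α := ℕ)).trans (by simpa using hle)
  have h2 : #(range (branchPoint (I := I))) ≤ 2 ^ #I :=
    mk_range_le.trans (by simp [mul_eq_self hle])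
  calc #(treeSpace H) ≤ _ := mk_le_mk_of_subset (treeSpace_subset_union_range hdec hcongr hdisj)
    _ ≤ _ := mk_union_le _ _
    _ ≤ 2 ^ #I + 2 ^ #I := add_le_add h1 h2
    _ = 2 ^ #I := add_eq_self hle

theorem seqCompactSpace_treeSpace [LinearOrder I] [WellFoundedLT I]
    (hdec : ∀ f i j, j < i → (H f i \ H f j).Finite)
    (hcongr : ∀ f g i, (∀ j ≤ i, f j = g j) → H f i = H g i)
    (hdisj : ∀ f g i, (∀ j < i, f j = g j) → f i ≠ g i → H f i ∩ H g i = ∅) :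
    SeqCompactSpace (treeSpace H) := by
  rw [← isSeqCompact_iff_seqCompactSpace]
  intro x hx
  by_cases hconst : ∃ n, {m | x m = memberPoint H n}.Infinite
  · obtain ⟨n, hn⟩ := hconst
    obtain ⟨φ, hφ, hφn⟩ := extraction_of_frequently_atTop (Nat.frequently_atTop_iff_infinite.2 hn)
    exact ⟨memberPoint H n, memberPoint_mem_treeSpace n, φ, hφ,
      tendsto_const_nhds.congr fun k => (hφn k).symm⟩
  push Not at hconst
  have htree : IsAlmostTree fun f i => {m | x m (f, i) = true} := by
    refine ⟨fun f i j hj => ?_, fun f g i h => ?_, fun f g i h hne => ?_⟩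
    · refine ((hdec f i j hj).biUnion fun n _ => hconst n).subset ?_
      rintro m ⟨h1, h2⟩
      obtain ⟨n, hn, hnm⟩ := mem_image_of_finite_diff (hx m) (s := (f, i)) (t := (f, j))
        (hdec f i j hj) h1 (Bool.not_eq_true _ ▸ h2)
      exact mem_iUnion₂.2 ⟨n, hn, hnm.symm⟩
    · ext m
      rw [mem_ofPred_eq, mem_ofPred_eq, eq_of_node_eq (hx m) (s := (f, i)) (t := (g, i))
        (hcongr f g i h)]
    · convert finite_empty
      exact eq_empty_of_forall_notMem fun m =>
        not_both_of_disjoint (hx m) (s := (f, i)) (t := (g, i)) (hdisj f g i h hne)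
  obtain ⟨c, hc, hsplit⟩ := htree.exists_infinite_not_split
  obtain ⟨φ, hφ, hφc⟩ := extraction_of_frequently_atTop (Nat.frequently_atTop_iff_infinite.2 hc)
  have hev : ∀ s, ∃ b, ∀ᶠ k in atTop, x (φ k) s = b := by
    rintro ⟨f, i⟩
    rcases hsplit f i with h | h
    · refine ⟨true, ?_⟩
      have := hφ.tendsto_atTop.eventually (Nat.cofinite_eq_atTop ▸ h.eventually_cofinite_notMem)
      filter_upwards [this] with k hk
      by_contra hne
      exact hk ⟨hφc k, hne⟩
    · refine ⟨false, ?_⟩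
      have := hφ.tendsto_atTop.eventually (Nat.cofinite_eq_atTop ▸ h.eventually_cofinite_notMem)
      filter_upwards [this] with k hk
      by_contra hne
      exact hk ⟨hφc k, by simpa using hne⟩
  choose y hy using hev
  have hlim : Tendsto (x ∘ φ) atTop (𝓝 y) :=
    tendsto_pi_nhds.2 fun s => tendsto_const_nhds.congr' ((hy s).mono fun _ h => h.symm)
  exact ⟨y, isClosed_treeSpace.mem_of_tendsto hlim (Eventually.of_forall fun k => hx (φ k)),
    φ, hφ, hlim⟩

end Space

/-- There is a separable, sequentially compact, compact Hausdorff space of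
cardinality exactly `2 ^ 𝔭`. -/
theorem statement17 :
    ∃ (X : Type) (t : TopologicalSpace X),
      @CompactSpace X t ∧ @T2Space X t ∧ @TopologicalSpace.SeparableSpace X t ∧
      @SeqCompactSpace X t ∧ Cardinal.mk X = 2 ^ pseudointersectionNumber := by
  obtain ⟨H, hinf, hdec, hcongr, hdisj⟩ :=
    exists_binary_tree (I := pseudointersectionNumber.ord.ToType) fun i => by
      simpa using Cardinal.mk_Iio_lt i
  have hcard : Cardinal.mk pseudointersectionNumber.ord.ToType = pseudointersectionNumber :=
    Cardinal.mk_ord_toType _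
  refine ⟨treeSpace H, inferInstance, isCompact_iff_compactSpace.1 isClosed_treeSpace.isCompact,
    inferInstance, separableSpace_treeSpace, seqCompactSpace_treeSpace hdec hcongr hdisj,
    le_antisymm ?_ ?_⟩
  · simpa only [hcard] using
      mk_treeSpace_le (hcard.symm ▸ aleph0_le_pseudointersectionNumber) hdec hcongr hdisj
  · simpa only [hcard] using two_power_le_mk_treeSpace hinf hdec hdisj
end

section
/- There exists a tree π-base for ω*: a family T of infinite subsets of ℕ such that (i) ordered by s ≤ t iff t ⊆* s, T is a tree, i.e. for each t ∈ T the set {s ∈ T : s < t} is well-ordered; (ii) for each ordinal ξ, the ξ-th level of T (elements whose set of strict predecessors has order type ξ), if nonempty, is an infinite maximal almost disjoint family of infinite subsets of ℕ; and (iii) for every infinite A ⊆ ℕ there is t ∈ T with t ⊆* A. -/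
/-- `y` is a `p`-limit of the sequence `x`: every open neighbourhood of `y`
contains `x n` for a `p`-large set of `n`. -/
def IsPLimit {X : Type*} [TopologicalSpace X] (p : Ultrafilter ℕ) (x : ℕ → X) (y : X) : Prop :=
  ∀ U : Set X, IsOpen U → y ∈ U → {n | x n ∈ U} ∈ p

/-- `X` is `p`-compact: every sequence in `X` has a `p`-limit. -/
def PCompact (X : Type*) [TopologicalSpace X] (p : Ultrafilter ℕ) : Prop :=
  ∀ x : ℕ → X, ∃ y : X, IsPLimit p x y

/-- An ultrafilter on `ℕ` is nonprincipal if it contains no finite set. -/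
def Nonprincipal (p : Ultrafilter ℕ) : Prop :=
  ∀ A : Set ℕ, A.Finite → A ∉ p

/-- `a ⊆* b`: `a \ b` is finite. -/
def AlmostSubset (a b : Set ℕ) : Prop := (a \ b).Finite

/-- `f : ℕ → ℕ` is finite-to-one: every fiber is finite. -/
def FiniteToOne (f : ℕ → ℕ) : Prop := ∀ n : ℕ, (f ⁻¹' {n}).Finite

/-- A topological space is countably compact if every countable open cover
has a finite subcover. -/
def CountablyCompact (X : Type*) [TopologicalSpace X] : Prop :=
  ∀ 𝒰 : Set (Set X), 𝒰.Countable → (∀ U ∈ 𝒰, IsOpen U) → ⋃₀ 𝒰 = Set.univ →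
    ∃ 𝒱 : Set (Set X), 𝒱 ⊆ 𝒰 ∧ 𝒱.Finite ∧ ⋃₀ 𝒱 = Set.univ

/-- The strict tree order on a tree π-base: `s < t` iff `t ⊆* s` but not `s ⊆* t`. -/
def TreeLT (s t : Set ℕ) : Prop := AlmostSubset t s ∧ ¬ AlmostSubset s t

/-- The set of strict predecessors of `t` inside `T`. -/
def predSet (T : Set (Set ℕ)) (t : Set ℕ) : Set (Set ℕ) := {s ∈ T | TreeLT s t}

/-- The strict order restricted to the predecessors of `t` in `T`. -/
def predRel (T : Set (Set ℕ)) (t : Set ℕ) : predSet T t → predSet T t → Prop :=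
  fun a b => TreeLT a.1 b.1

/-- The set of strict predecessors of `t` in `T` is well-ordered with order type `ξ`. -/
def HasPredOrderType (T : Set (Set ℕ)) (t : Set ℕ) (ξ : Ordinal) : Prop :=
  ∃ h : IsWellOrder (predSet T t) (predRel T t), @Ordinal.type _ (predRel T t) h = ξ

/-- The `ξ`-th level of `T`: elements whose set of strict predecessors has order type `ξ`. -/
def TreeLevel (T : Set (Set ℕ)) (ξ : Ordinal) : Set (Set ℕ) :=
  {t ∈ T | HasPredOrderType T t ξ}

/-- A maximal almost disjoint family of infinite subsets of `ℕ`. -/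
def IsMadFamily (A : Set (Set ℕ)) : Prop :=
  (∀ a ∈ A, a.Infinite) ∧
  (∀ a ∈ A, ∀ b ∈ A, a ≠ b → (a ∩ b).Finite) ∧
  (∀ x : Set ℕ, x.Infinite → ∃ a ∈ A, (x ∩ a).Infinite)

/-- `T` is a tree π-base for `ω*`. -/
structure IsTreePiBase (T : Set (Set ℕ)) : Prop where
  /-- members are infinite subsets of `ℕ` -/
  infinite_mem : ∀ t ∈ T, t.Infinite
  /-- `T` is a tree: the strict predecessors of each element are well-ordered -/
  tree : ∀ t ∈ T, IsWellOrder (predSet T t) (predRel T t)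
  /-- each nonempty level is an infinite maximal almost disjoint family -/
  levels : ∀ ξ : Ordinal, (TreeLevel T ξ).Nonempty →
    (TreeLevel T ξ).Infinite ∧ IsMadFamily (TreeLevel T ξ)
  /-- `T` is a π-base: every infinite `A ⊆ ℕ` almost contains a member of `T` -/
  pibase : ∀ A : Set ℕ, A.Infinite → ∃ t ∈ T, AlmostSubset t A

/-- `ξ` is the height of `T`: the least ordinal whose level is empty. -/
def IsHeight (T : Set (Set ℕ)) (ξ : Ordinal) : Prop :=
  TreeLevel T ξ = ∅ ∧ ∀ η : Ordinal, η < ξ → (TreeLevel T η).Nonempty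

/-- A cofinal branch of `T`: a maximal chain (in the order `s ≤ t ↔ t ⊆* s`)
meeting every nonempty level. -/
def IsCofinalBranch (T b : Set (Set ℕ)) : Prop :=
  b ⊆ T ∧ IsChain (fun s t => AlmostSubset t s) b ∧
  (∀ c : Set (Set ℕ), c ⊆ T → IsChain (fun s t => AlmostSubset t s) c → b ⊆ c → b = c) ∧
  ∀ ξ : Ordinal, (TreeLevel T ξ).Nonempty → (b ∩ TreeLevel T ξ).Nonempty

/-- The principle `(*)`: there is no tree π-base for `ω*` of height `< 𝔠`, and
every tree π-base of height `𝔠` has a cofinal branch. -/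
def StarPrinciple : Prop :=
  (∀ T : Set (Set ℕ), ∀ ξ : Ordinal, IsTreePiBase T → IsHeight T ξ →
      ¬ ξ < Cardinal.continuum.ord) ∧
  (∀ T : Set (Set ℕ), IsTreePiBase T → IsHeight T Cardinal.continuum.ord →
      ∃ b : Set (Set ℕ), IsCofinalBranch T b)

open Set Function Cardinal

theorem AlmostSubset.of_subset {a b : Set ℕ} (h : a ⊆ b) : AlmostSubset a b := by
  simp [AlmostSubset, sdiff_eq_empty.2 h]

theorem AlmostSubset.trans {a b c : Set ℕ} (h : AlmostSubset a b) (h' : AlmostSubset b c) :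
    AlmostSubset a c :=
  (h.union h').subset fun x hx => by
    by_cases hb : x ∈ b
    · exact Or.inr ⟨hb, hx.2⟩
    · exact Or.inl ⟨hx.1, hb⟩

theorem AlmostSubset.infinite_inter {a b c d : Set ℕ} (h : AlmostSubset a c)
    (h' : AlmostSubset b d) (hi : (a ∩ b).Infinite) : (c ∩ d).Infinite := by
  intro hf
  refine hi (((h.union h').union hf).subset fun x hx => ?_)
  by_cases hc : x ∈ c
  · by_cases hd : x ∈ d
    · exact Or.inr ⟨hc, hd⟩
    · exact Or.inl (Or.inr ⟨hx.2, hd⟩)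
  · exact Or.inl (Or.inl ⟨hx.1, hc⟩)

theorem AlmostSubset.infinite_inter_of_infinite {a c d : Set ℕ} (h : AlmostSubset a c)
    (h' : AlmostSubset a d) (hi : a.Infinite) : (c ∩ d).Infinite :=
  h.infinite_inter h' (by rwa [inter_self])

theorem IsMadFamily.eq_of_infinite_inter {B : Set (Set ℕ)} (hB : IsMadFamily B) {s t : Set ℕ}
    (hs : s ∈ B) (ht : t ∈ B) (h : (s ∩ t).Infinite) : s = t := by
  by_contra hne
  exact h (hB.2.1 s hs t ht hne)

/-- A family of infinite subsets of `ℕ` that is closed downwards under `⊆*` and dense. -/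
structure OpenDense (D : Set (Set ℕ)) : Prop where
  infinite : ∀ Y ∈ D, Y.Infinite
  mem_of_almostSubset : ∀ Y ∈ D, ∀ Z : Set ℕ, Z.Infinite → AlmostSubset Z Y → Z ∈ D
  exists_subset : ∀ Z : Set ℕ, Z.Infinite → ∃ Y ∈ D, Y ⊆ Z

theorem exists_infinite_disjoint_sets :
    ∃ P : ℕ → Set ℕ, (∀ n, (P n).Infinite) ∧ ∀ m n, m ≠ n → Disjoint (P m) (P n) := by
  refine ⟨fun n => range (Nat.pair n), fun n => infinite_range_of_injective fun a b h => ?_,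
    fun m n h => ?_⟩
  · exact (Nat.pair_eq_pair.1 h).2
  · rw [Set.disjoint_left]
    rintro _ ⟨a, rfl⟩ ⟨b, hb⟩
    exact h (Nat.pair_eq_pair.1 hb).1.symm

theorem Set.Infinite.exists_split {X : Set ℕ} (hX : X.Infinite) :
    ∃ u ⊆ X, u.Infinite ∧ (X \ u).Infinite := by
  obtain ⟨P, hP, hd⟩ := exists_infinite_disjoint_sets
  let e : ℕ → ℕ := fun n => hX.natEmbedding X n
  have he : Injective e := Subtype.val_injective.comp (hX.natEmbedding X).injective
  have hm : ∀ n, e n ∈ X := fun n => (hX.natEmbedding X n).2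
  refine ⟨e '' P 0, ?_, (hP 0).image he.injOn, ((hP 1).image he.injOn).mono ?_⟩
  · rintro _ ⟨n, -, rfl⟩
    exact hm n
  · rintro _ ⟨n, hn, rfl⟩
    refine ⟨hm n, ?_⟩
    rintro ⟨k, hk, hkn⟩
    rw [he hkn] at hk
    exact Set.disjoint_left.1 (hd 0 1 zero_ne_one) hk hn

/-- Every decreasing sequence of infinite sets has an infinite pseudo-intersection. -/
theorem exists_pseudoIntersection {Z : ℕ → Set ℕ} (hZ : Antitone Z) (hi : ∀ n, (Z n).Infinite) :
    ∃ Y : Set ℕ, Y.Infinite ∧ Y ⊆ Z 0 ∧ ∀ n, AlmostSubset Y (Z n) := by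
  choose y hy hlt using fun n => (hi n).exists_gt n
  refine ⟨range y, ?_, ?_, fun n => ?_⟩
  · refine infinite_of_not_bddAbove ?_
    rintro ⟨b, hb⟩
    exact (hlt b).not_ge (hb ⟨b, rfl⟩)
  · rintro _ ⟨n, rfl⟩
    exact hZ (Nat.zero_le n) (hy n)
  · refine ((finite_Iio n).image y).subset ?_
    rintro _ ⟨⟨k, rfl⟩, hk⟩
    refine ⟨k, ?_, rfl⟩
    by_contra hkn
    exact hk (hZ (not_lt.1 hkn) (hy k))

namespace OpenDense

theorem inter {D E : Set (Set ℕ)} (hD : OpenDense D) (hE : OpenDense E) : OpenDense (D ∩ E) where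
  infinite Y hY := hD.infinite Y hY.1
  mem_of_almostSubset Y hY Z hZ h :=
    ⟨hD.mem_of_almostSubset Y hY.1 Z hZ h, hE.mem_of_almostSubset Y hY.2 Z hZ h⟩
  exists_subset Z hZ := by
    obtain ⟨Y, hY, hYZ⟩ := hD.exists_subset Z hZ
    obtain ⟨W, hW, hWY⟩ := hE.exists_subset Y (hD.infinite Y hY)
    exact ⟨W, ⟨hD.mem_of_almostSubset Y hY W (hE.infinite W hW) (.of_subset hWY), hW⟩,
      hWY.trans hYZ⟩

theorem setOf_infinite : OpenDense {Y : Set ℕ | Y.Infinite} where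
  infinite _ hY := hY
  mem_of_almostSubset _ _ _ hZ _ := hZ
  exists_subset Z hZ := ⟨Z, hZ, Subset.rfl⟩

theorem iInter_nat {D : ℕ → Set (Set ℕ)} (hD : ∀ n, OpenDense (D n)) :
    OpenDense (⋂ n, D n) where
  infinite Y hY := (hD 0).infinite Y (mem_iInter.1 hY 0)
  mem_of_almostSubset Y hY Z hZ h :=
    mem_iInter.2 fun n => (hD n).mem_of_almostSubset Y (mem_iInter.1 hY n) Z hZ h
  exists_subset Z hZ := by
    choose! r hr hsub using fun n => (hD n).exists_subset
    let W : ℕ → Set ℕ := fun n => Nat.rec Z (fun k w => r k w) n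
    have hW : ∀ n, (W n).Infinite := fun n => by
      induction n with
      | zero => exact hZ
      | succ k ih => exact (hD k).infinite _ (hr k _ ih)
    obtain ⟨Y, hY, hY0, hYn⟩ := exists_pseudoIntersection
      (antitone_nat_of_succ_le fun n => hsub n (W n) (hW n)) hW
    exact ⟨Y, mem_iInter.2 fun n =>
      (hD n).mem_of_almostSubset (W (n + 1)) (hr n _ (hW n)) Y hY (hYn (n + 1)), hY0⟩

/-- Every open dense family contains an infinite maximal almost disjoint family. -/
theorem exists_isMadFamily {E : Set (Set ℕ)} (hE : OpenDense E) :
    ∃ B ⊆ E, B.Infinite ∧ IsMadFamily B := by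
  obtain ⟨P, hP, hd⟩ := exists_infinite_disjoint_sets
  choose y hyE hyP using fun n => hE.exists_subset (P n) (hP n)
  have hyd : ∀ m n, m ≠ n → y m ∩ y n = ∅ := fun m n h =>
    disjoint_iff_inter_eq_empty.1 ((hd m n h).mono (hyP m) (hyP n))
  have hinj : Injective y := by
    intro m n h
    by_contra hmn
    have := hyd m n hmn
    rw [← h, inter_self] at this
    exact hE.infinite _ (hyE m) (this ▸ finite_empty)
  obtain ⟨B, hCB, hB⟩ := zorn_subset_nonempty
    {B | B ⊆ E ∧ B.Pairwise fun a b => (a ∩ b).Finite} (fun c hc hch _ =>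
      ⟨⋃₀ c, ⟨sUnion_subset fun b hb => (hc hb).1,
        (pairwise_sUnion hch.directedOn).2 fun b hb => (hc hb).2⟩,
        fun _ hs => subset_sUnion_of_mem hs⟩) (range y) ⟨by rintro _ ⟨n, rfl⟩; exact hyE n, by
      rintro _ ⟨m, rfl⟩ _ ⟨n, rfl⟩ h
      rw [hyd m n (fun hmn => h (hmn ▸ rfl))]
      exact finite_empty⟩
  refine ⟨B, hB.prop.1, (infinite_range_of_injective hinj).mono hCB,
    fun a ha => hE.infinite a (hB.prop.1 ha), fun a ha b hb h => hB.prop.2 ha hb h,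
    fun x hx => ?_⟩
  by_contra! hno
  obtain ⟨z, hz, hzx⟩ := hE.exists_subset x hx
  have hfin : ∀ a ∈ B, (z ∩ a).Finite := fun a ha =>
    (hno a ha).subset (inter_subset_inter_left _ hzx)
  have hzB : z ∈ B := hB.le_of_ge (y := insert z B) ⟨insert_subset hz hB.prop.1,
    hB.prop.2.insert fun a ha _ => ⟨hfin a ha, inter_comm z a ▸ hfin a ha⟩⟩
    (subset_insert z B) (mem_insert z B)
  exact hE.infinite z hz (by simpa using hfin z hzB)

end OpenDense

/-- A family of sets, each at least as large as the index type, has an injective choice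
function. -/
theorem Cardinal.exists_injective_mem {I J : Type} (S : I → Set J) (h : ∀ i, #I ≤ #(S i)) :
    ∃ f : I → J, Injective f ∧ ∀ i, f i ∈ S i := by
  obtain ⟨_, _, ho⟩ := exists_ord_eq_type_lt I
  have key : ∀ i (g : (j : I) → j < i → J), ∃ x ∈ S i, ∀ j hj, g j hj ≠ x := by
    intro i g
    by_contra! hno
    have hle : #(S i) ≤ #(Iio i) := by
      have : S i ⊆ range fun j : Iio i => g j j.2 := fun x hx =>
        let ⟨j, hj, e⟩ := hno x hx
        ⟨⟨j, hj⟩, e⟩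
      exact (mk_le_mk_of_subset this).trans mk_range_le
    exact ((h i).trans hle).not_gt (mk_Iio_lt i ho)
  choose c hc hne using key
  let f : I → J := wellFounded_lt.fix c
  have hf : ∀ i, f i = c i fun j _ => f j := fun i => wellFounded_lt.fix_eq c i
  have hlt : ∀ i j, j < i → f j ≠ f i := fun i j hji => by
    rw [hf i]
    exact hne i (fun j _ => f j) j hji
  refine ⟨f, fun i j hij => ?_, fun i => hf i ▸ hc i _⟩
  by_contra hne'
  rcases lt_or_gt_of_ne hne' with h | h
  · exact hlt j i h hij
  · exact hlt i j h hij.symm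

/-- Every maximal almost disjoint family `B` is strictly refined by an open dense family, in such a
way that each set meeting continuum many members of `B` almost contains all members of the
refinement that meet some fixed infinite set. -/
theorem IsMadFamily.exists_refinement {B : Set (Set ℕ)} (hB : IsMadFamily B) :
    ∃ R, OpenDense R ∧ (∀ Y ∈ R, ∃ t ∈ B, AlmostSubset Y t ∧ ¬ AlmostSubset t Y) ∧
      ∀ X : Set ℕ, #(Set ℕ) ≤ #{t ∈ B | (X ∩ t).Infinite} →
        ∃ u : Set ℕ, u.Infinite ∧ ∀ Y ∈ R, (Y ∩ u).Infinite → AlmostSubset Y X := by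
  obtain ⟨f, hf, hfm⟩ := Cardinal.exists_injective_mem
    (I := {X : Set ℕ // #(Set ℕ) ≤ #{t ∈ B | (X ∩ t).Infinite}})
    (fun X => {t ∈ B | (X.1 ∩ t).Infinite}) (fun X => (mk_subtype_le _).trans X.2)
  have hu : ∀ t ∈ B, ∃ u ⊆ t, u.Infinite ∧ (t \ u).Infinite ∧ ∀ X, f X = t → u ⊆ X.1 := by
    intro t ht
    by_cases hX : ∃ X, f X = t
    · obtain ⟨X, rfl⟩ := hX
      obtain ⟨u, hu, hui, hud⟩ := (hfm X).2.exists_split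
      refine ⟨u, hu.trans inter_subset_right, hui,
        hud.mono (sdiff_subset_sdiff_left inter_subset_right), fun X' h => ?_⟩
      rw [hf h]
      exact hu.trans inter_subset_left
    · obtain ⟨u, hu, hui, hud⟩ := (hB.1 t ht).exists_split
      exact ⟨u, hu, hui, hud, fun X h => (hX ⟨X, h⟩).elim⟩
  choose! u hut hui hud huX using hu
  refine ⟨{Y | Y.Infinite ∧ ∃ t ∈ B, AlmostSubset Y (u t) ∨ AlmostSubset Y (t \ u t)},
    ⟨fun Y hY => hY.1, ?_, ?_⟩, ?_, ?_⟩
  · rintro Y ⟨-, t, ht, h⟩ Z hZ hZY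
    exact ⟨hZ, t, ht, h.imp hZY.trans hZY.trans⟩
  · intro Z hZ
    obtain ⟨t, ht, hi⟩ := hB.2.2 Z hZ
    by_cases h : (Z ∩ u t).Infinite
    · exact ⟨_, ⟨h, t, ht, .inl (.of_subset inter_subset_right)⟩, inter_subset_left⟩
    · refine ⟨(Z ∩ t) \ (Z ∩ u t), ⟨hi.sdiff (not_infinite.1 h), t, ht,
        .inr (.of_subset fun x hx => ⟨hx.1.2, fun hxu => hx.2 ⟨hx.1.1, hxu⟩⟩)⟩,
        sdiff_subset.trans inter_subset_left⟩
  · rintro Y ⟨-, t, ht, h | h⟩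
    · exact ⟨t, ht, h.trans (.of_subset (hut t ht)), fun h' => hud t ht (h'.trans h)⟩
    · refine ⟨t, ht, h.trans (.of_subset sdiff_subset), fun h' => hui t ht ?_⟩
      have := h'.trans h
      rwa [AlmostSubset, sdiff_sdiff_cancel_left (hut t ht)] at this
  · intro X hX
    have hfX := hfm ⟨X, hX⟩
    set s := f ⟨X, hX⟩ with hs
    refine ⟨u s, hui s hfX.1, ?_⟩
    rintro Y ⟨-, t, ht, h⟩ hYi
    have hYt : AlmostSubset Y t :=
      h.elim (·.trans (.of_subset (hut t ht))) (·.trans (.of_subset sdiff_subset))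
    have hts : t = s := hB.eq_of_infinite_inter ht hfX.1
      (hYt.infinite_inter (.of_subset (hut s hfX.1)) hYi)
    subst hts
    rcases h with h | h
    · exact h.trans (.of_subset (huX _ hfX.1 _ hs.symm))
    · refine ((h.infinite_inter (.of_subset Subset.rfl) hYi) ?_).elim
      rw [sdiff_inter_self]
      exact finite_empty

/-- The open dense families `D α`, for `α < κ`, have empty intersection, and `κ` is minimal in the
sense that fewer open dense families have open dense intersection. -/
structure IsDistributivityWitness (κ : Ordinal.{0}) (D : Ordinal.{0} → Set (Set ℕ)) : Prop where
  openDense : ∀ α, OpenDense (D α)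
  exists_notMem : ∀ X : Set ℕ, X.Infinite → ∃ α < κ, X ∉ D α
  openDense_inter : ∀ α < κ, ∀ E : Ordinal.{0} → Set (Set ℕ), (∀ β < α, OpenDense (E β)) →
    OpenDense {Y | Y.Infinite ∧ ∀ β < α, Y ∈ E β}

theorem exists_openDense_inter_empty :
    ∃ (κ : Ordinal.{0}) (E : Ordinal.{0} → Set (Set ℕ)), (∀ β, OpenDense (E β)) ∧
      ¬ OpenDense {Y | Y.Infinite ∧ ∀ β < κ, Y ∈ E β} := by
  let r : Set ℕ → Set ℕ → Prop := WellOrderingRel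
  refine ⟨Ordinal.type r, fun α => {Y | Y.Infinite ∧ ∀ X : Set ℕ, X.Infinite →
    Ordinal.typein r X = α → ¬ AlmostSubset X Y}, fun α => ⟨fun Y hY => hY.1, ?_, ?_⟩, ?_⟩
  · rintro Y ⟨-, hY⟩ Z hZ hZY
    exact ⟨hZ, fun X hX hα h => hY X hX hα (h.trans hZY)⟩
  · intro Z hZ
    obtain ⟨u, huZ, hu, hu'⟩ := hZ.exists_split
    by_cases h : ∃ X : Set ℕ, X.Infinite ∧ Ordinal.typein r X = α ∧ AlmostSubset X u
    · obtain ⟨X, hX, hα, hXu⟩ := h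
      refine ⟨Z \ u, ⟨hu', fun X' _ hα' h' => ?_⟩, sdiff_subset⟩
      rw [← hα, Ordinal.typein_inj] at hα'
      subst hα'
      refine hXu.infinite_inter_of_infinite h' hX ?_
      rw [inter_sdiff_self]
      exact finite_empty
    · push Not at h
      exact ⟨u, ⟨hu, fun X hX hα => h X hX hα⟩, huZ⟩
  · intro h
    obtain ⟨Y, hY, -⟩ := h.exists_subset univ infinite_univ
    exact (hY.2 _ (Ordinal.typein_lt_type r Y)).2 Y hY.1 rfl (.of_subset Subset.rfl)

theorem OpenDense.image_mem {E : Set (Set ℕ)} (hE : OpenDense E) {e : ℕ → ℕ} (he : Injective e) :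
    OpenDense {Y | e '' Y ∈ E} where
  infinite Y hY := (hE.infinite _ hY).of_image e
  mem_of_almostSubset Y hY Z hZ h := by
    refine hE.mem_of_almostSubset _ hY _ (hZ.image he.injOn) ?_
    rw [AlmostSubset, ← image_sdiff he]
    exact h.image e
  exists_subset Z hZ := by
    obtain ⟨V, hV, hVZ⟩ := hE.exists_subset _ (hZ.image he.injOn)
    refine ⟨e ⁻¹' V, ?_, (preimage_mono hVZ).trans (preimage_image_eq Z he).subset⟩
    rwa [mem_ofPred_eq, image_preimage_eq_of_subset (hVZ.trans (image_subset_range e Z))]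

theorem exists_isDistributivityWitness : ∃ κ D, IsDistributivityWitness κ D := by
  obtain ⟨κ, ⟨E, hE, hκ⟩, hmin⟩ :=
    WellFounded.has_min (wellFounded_lt (α := Ordinal.{0})) {κ | ∃ E : Ordinal.{0} → Set (Set ℕ),
      (∀ β, OpenDense (E β)) ∧ ¬ OpenDense {Y | Y.Infinite ∧ ∀ β < κ, Y ∈ E β}}
      exists_openDense_inter_empty
  have hZ : ∃ Z : Set ℕ, Z.Infinite ∧
      ∀ Y : Set ℕ, Y.Infinite → (∀ β < κ, Y ∈ E β) → ¬ Y ⊆ Z := by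
    by_contra! hno
    refine hκ ⟨fun Y hY => hY.1, fun Y hY Z hZ h => ⟨hZ, fun β hβ =>
      (hE β).mem_of_almostSubset Y (hY.2 β hβ) Z hZ h⟩, fun Z hZ => ?_⟩
    obtain ⟨Y, hY, hYE, hYZ⟩ := hno Z hZ
    exact ⟨Y, ⟨hY, hYE⟩, hYZ⟩
  obtain ⟨Z, hZ, hno⟩ := hZ
  let e : ℕ → ℕ := fun n => hZ.natEmbedding Z n
  have he : Injective e := Subtype.val_injective.comp (hZ.natEmbedding Z).injective
  refine ⟨κ, fun α => {Y | e '' Y ∈ E α}, fun α => (hE α).image_mem he, fun X hX => ?_,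
    fun α hα F hF => ?_⟩
  · by_contra! h
    refine hno (e '' X) (hX.image he.injOn) h ?_
    rintro _ ⟨n, -, rfl⟩
    exact (hZ.natEmbedding Z n).2
  · classical
    by_contra h
    refine hmin α ⟨fun β => if β < α then F β else {Y | Y.Infinite}, fun β => ?_, ?_⟩ hα
    · beta_reduce
      split_ifs with hβ
      · exact hF β hβ
      · exact .setOf_infinite
    · have heq : ∀ Y : Set ℕ, (∀ β < α, Y ∈ if β < α then F β else {Y | Y.Infinite}) ↔
          ∀ β < α, Y ∈ F β := fun Y => forall₂_congr fun β hβ => by rw [if_pos hβ]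
      simpa only [heq] using h

namespace IsDistributivityWitness

variable {κ : Ordinal.{0}} {D B : Ordinal.{0} → Set (Set ℕ)}

theorem exists_bound (h : IsDistributivityWitness κ D) {ι : Type} [Countable ι] [Nonempty ι]
    (a : ι → Ordinal.{0}) (ha : ∀ i, a i < κ) : ∃ γ < κ, ∀ i, a i < γ := by
  by_contra! hno
  obtain ⟨f, hf⟩ := exists_surjective_nat ι
  obtain ⟨Y, hY, -⟩ := (OpenDense.iInter_nat fun n => (h.openDense (a (f n))).inter
    (h.openDense_inter _ (ha (f n)) D fun β _ => h.openDense β)).exists_subset univ infinite_univ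
  rw [mem_iInter] at hY
  obtain ⟨α, hα, hYα⟩ := h.exists_notMem Y (hY 0).2.1
  obtain ⟨i, hi⟩ := hno α hα
  obtain ⟨n, rfl⟩ := hf i
  rcases hi.eq_or_lt with rfl | hlt
  · exact hYα (hY n).1
  · exact hYα ((hY n).2.2 α hlt)

theorem exists_meets_two (h : IsDistributivityWitness κ D)
    (hBD : ∀ α < κ, B α ⊆ D α) (hB : ∀ α < κ, IsMadFamily (B α)) {X : Set ℕ} (hX : X.Infinite) :
    ∃ α < κ, ∃ t ∈ B α, ∃ t' ∈ B α, t ≠ t' ∧ (X ∩ t).Infinite ∧ (X ∩ t').Infinite := by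
  obtain ⟨α, hα, hXα⟩ := h.exists_notMem X hX
  obtain ⟨t, ht, hXt⟩ := (hB α hα).2.2 X hX
  have hd : (X \ t).Infinite := fun hf =>
    hXα ((h.openDense α).mem_of_almostSubset t (hBD α hα ht) X hX hf)
  obtain ⟨t', ht', hXt'⟩ := (hB α hα).2.2 _ hd
  refine ⟨α, hα, t, ht, t', ht', ?_, hXt, hXt'.mono (inter_subset_inter_left _ sdiff_subset)⟩
  rintro rfl
  rw [sdiff_inter_self] at hXt'
  exact hXt' finite_empty

/-- In a refining matrix of maximal almost disjoint families, every infinite set meets continuum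
many members of some level. -/
theorem exists_meets_continuum (h : IsDistributivityWitness κ D)
    (hBD : ∀ α < κ, B α ⊆ D α) (hB : ∀ α < κ, IsMadFamily (B α))
    (href : ∀ α < κ, ∀ β < α, ∀ Y ∈ B α, ∃ t ∈ B β, AlmostSubset Y t)
    {X : Set ℕ} (hX : X.Infinite) :
    ∃ γ < κ, #(Set ℕ) ≤ #{t ∈ B γ | (X ∩ t).Infinite} := by
  choose! a ha t ht t' ht' hne hi hi' using fun X hX => h.exists_meets_two hBD hB (X := X) hX
  let side : Bool → Set ℕ → Set ℕ := fun b W => cond b (t W) (t' W)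
  have hside : ∀ b W, W.Infinite → side b W ∈ B (a W) ∧ (W ∩ side b W).Infinite := by
    rintro (_ | _) W hW
    · exact ⟨ht' W hW, hi' W hW⟩
    · exact ⟨ht W hW, hi W hW⟩
  let q : List Bool → Set ℕ := fun s => s.foldr (fun b W => W ∩ side b W) X
  have hq : ∀ s, (q s).Infinite := fun s => by
    induction s with
    | nil => exact hX
    | cons b s ih => exact (hside b _ ih).2
  obtain ⟨γ, hγ, hlt⟩ := h.exists_bound (fun s => a (q s)) fun s => ha _ (hq s)
  let pre : (ℕ → Bool) → ℕ → List Bool := fun g n => Nat.rec [] (fun k l => g k :: l) n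
  have hpre : ∀ (g g' : ℕ → Bool) n, (∀ m < n, g m = g' m) → pre g n = pre g' n := by
    intro g g' n hn
    induction n with
    | zero => rfl
    | succ k ih =>
      change g k :: pre g k = g' k :: pre g' k
      rw [hn k k.lt_succ_self, ih fun m hm => hn m (hm.trans k.lt_succ_self)]
  choose Y hYi hYX hYq using fun g : ℕ → Bool => exists_pseudoIntersection
    (Z := fun n => q (pre g n)) (antitone_nat_of_succ_le fun n => inter_subset_left)
    fun n => hq _
  choose z hz hYz using fun g => (hB γ hγ).2.2 (Y g) (hYi g)
  have hzside : ∀ g n, AlmostSubset (z g) (side (g n) (q (pre g n))) := by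
    intro g n
    have hW := hq (pre g n)
    obtain ⟨r, hr, hzr⟩ := href γ hγ _ (hlt (pre g n)) (z g) (hz g)
    have hYs : AlmostSubset (Y g) (side (g n) (q (pre g n))) :=
      (hYq g (n + 1)).trans (.of_subset inter_subset_right)
    rwa [(hB _ (ha _ hW)).eq_of_infinite_inter (hside _ _ hW).1 hr
      (hYs.infinite_inter hzr (hYz g))]
  have hzinj : Injective z := by
    intro g g' hgg'
    by_contra hne'
    have hex : ∃ n, g n ≠ g' n := ne_iff.1 hne'
    classical
    let n := Nat.find hex
    have hp : pre g n = pre g' n := hpre g g' n fun m hm => not_not.1 (Nat.find_min hex hm)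
    have hn : g n ≠ g' n := Nat.find_spec hex
    have h1 := hzside g n
    have h2 := hzside g' n
    rw [← hgg', ← hp] at h2
    have hW := hq (pre g n)
    have heq := (hB _ (ha _ hW)).eq_of_infinite_inter (hside (g n) _ hW).1 (hside (g' n) _ hW).1
      (h1.infinite_inter_of_infinite h2 ((hB γ hγ).1 _ (hz g)))
    cases hg : g n <;> cases hg' : g' n <;> rw [hg, hg'] at hn heq
    · exact hn rfl
    · exact hne _ hW heq.symm
    · exact hne _ hW heq
    · exact hn rfl
  refine ⟨γ, hγ, ?_⟩
  have hcard : #(Set ℕ) = #(ℕ → Bool) := by simp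
  rw [hcard]
  refine mk_le_of_injective (f := fun g => ⟨z g, hz g, ?_⟩) fun g g' hg =>
    hzinj (congrArg Subtype.val hg)
  exact (hYz g).mono (inter_subset_inter_left _ (hYX g))

end IsDistributivityWitness

/-- A refining matrix of maximal almost disjoint families of height `κ` whose members form a
π-base. -/
structure IsBaseMatrix (κ : Ordinal.{0}) (B : Ordinal.{0} → Set (Set ℕ)) : Prop where
  infinite : ∀ α < κ, (B α).Infinite
  isMadFamily : ∀ α < κ, IsMadFamily (B α)
  refines : ∀ α < κ, ∀ β < α, ∀ Y ∈ B α, ∃ t ∈ B β, AlmostSubset Y t ∧ ¬ AlmostSubset t Y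
  exists_almostSubset : ∀ X : Set ℕ, X.Infinite → ∃ α < κ, ∃ Y ∈ B α, AlmostSubset Y X

theorem exists_isBaseMatrix : ∃ κ B, IsBaseMatrix κ B := by
  obtain ⟨κ, D, h⟩ := exists_isDistributivityWitness
  choose! M hME hMi hM using fun E => OpenDense.exists_isMadFamily (E := E)
  choose! R hR hRs hRX using fun B => IsMadFamily.exists_refinement (B := B)
  let F : (α : Ordinal.{0}) → ((β : Ordinal.{0}) → β < α → Set (Set ℕ)) → Set (Set ℕ) :=
    fun α g => M (D α ∩ {Y | Y.Infinite ∧ ∀ β (hβ : β < α), Y ∈ R (g β hβ)})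
  let B : Ordinal.{0} → Set (Set ℕ) := wellFounded_lt.fix F
  have hBeq : ∀ α, B α = M (D α ∩ {Y | Y.Infinite ∧ ∀ β < α, Y ∈ R (B β)}) :=
    fun α => wellFounded_lt.fix_eq F α
  have hdense : ∀ α < κ, OpenDense (D α ∩ {Y | Y.Infinite ∧ ∀ β < α, Y ∈ R (B β)}) := by
    intro α
    induction α using WellFoundedLT.induction with
    | ind α ih =>
      intro hα
      refine (h.openDense α).inter (h.openDense_inter α hα (fun β => R (B β)) fun β hβ => ?_)
      refine hR _ ?_
      rw [hBeq β]
      exact hM _ (ih β hβ (hβ.trans hα))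
  have hmad : ∀ α < κ, IsMadFamily (B α) := fun α hα => hBeq α ▸ hM _ (hdense α hα)
  have hsub : ∀ α < κ, B α ⊆ D α ∩ {Y | Y.Infinite ∧ ∀ β < α, Y ∈ R (B β)} := by
    intro α hα
    conv_lhs => rw [hBeq α]
    exact hME _ (hdense α hα)
  have href : ∀ α < κ, ∀ β < α, ∀ Y ∈ B α, ∃ t ∈ B β, AlmostSubset Y t ∧ ¬ AlmostSubset t Y :=
    fun α hα β hβ Y hY => hRs _ (hmad β (hβ.trans hα)) Y ((hsub α hα hY).2.2 β hβ)
  refine ⟨κ, B, fun α hα => hBeq α ▸ hMi _ (hdense α hα), hmad, href, fun X hX => ?_⟩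
  obtain ⟨γ, hγ, hc⟩ := h.exists_meets_continuum (fun α hα => (hsub α hα).trans inter_subset_left)
    hmad (fun α hα β hβ Y hY => (href α hα β hβ Y hY).imp fun t ht => ⟨ht.1, ht.2.1⟩) hX
  obtain ⟨u, hu, huY⟩ := hRX _ (hmad γ hγ) X hc
  obtain ⟨α, hα, hγα⟩ := h.exists_bound (fun _ : Unit => γ) fun _ => hγ
  obtain ⟨Y, hY, hYu⟩ := (hmad α hα).2.2 u hu
  exact ⟨α, hα, Y, hY, huY Y ((hsub α hα hY).2.2 γ (hγα ())) (inter_comm u Y ▸ hYu)⟩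

namespace IsBaseMatrix

variable {κ : Ordinal.{0}} {B : Ordinal.{0} → Set (Set ℕ)}

theorem treeLT_iff (h : IsBaseMatrix κ B) {α β : Ordinal.{0}} (hα : α < κ) (hβ : β < κ)
    {s t : Set ℕ} (hs : s ∈ B β) (ht : t ∈ B α) :
    TreeLT s t ↔ β < α ∧ AlmostSubset t s := by
  have hti := (h.isMadFamily α hα).1 t ht
  constructor
  · rintro ⟨hts, hst⟩
    refine ⟨?_, hts⟩
    by_contra hle
    rcases (not_lt.1 hle).eq_or_lt with rfl | hlt
    · have heq := (h.isMadFamily α hα).eq_of_infinite_inter hs ht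
        (hts.infinite_inter_of_infinite (.of_subset Subset.rfl) hti)
      exact hst (.of_subset heq.subset)
    · obtain ⟨r, hr, hsr, -⟩ := h.refines β hβ α hlt s hs
      have heq := (h.isMadFamily α hα).eq_of_infinite_inter hr ht
        ((hts.trans hsr).infinite_inter_of_infinite (.of_subset Subset.rfl) hti)
      exact hst (heq ▸ hsr)
  · rintro ⟨hlt, hts⟩
    refine ⟨hts, ?_⟩
    obtain ⟨r, hr, htr, hrt⟩ := h.refines α hα β hlt t ht
    rwa [(h.isMadFamily β hβ).eq_of_infinite_inter hs hr (hts.infinite_inter_of_infinite htr hti)]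

theorem level_unique (h : IsBaseMatrix κ B) {α β : Ordinal.{0}} (hα : α < κ) (hβ : β < κ)
    {t : Set ℕ} (ht : t ∈ B α) (ht' : t ∈ B β) : α = β := by
  have hself : AlmostSubset t t := .of_subset Subset.rfl
  rcases lt_trichotomy α β with hlt | heq | hlt
  · exact (((h.treeLT_iff hβ hα ht ht').2 ⟨hlt, hself⟩).2 hself).elim
  · exact heq
  · exact (((h.treeLT_iff hα hβ ht' ht).2 ⟨hlt, hself⟩).2 hself).elim

theorem hasPredOrderType (h : IsBaseMatrix κ B) {α : Ordinal.{0}} (hα : α < κ) {t : Set ℕ}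
    (ht : t ∈ B α) : HasPredOrderType {t | ∃ α < κ, t ∈ B α} t α := by
  set T := {t | ∃ α < κ, t ∈ B α} with hT
  have hti := (h.isMadFamily α hα).1 t ht
  choose! p hp htp _ using fun β hβ => h.refines α hα β hβ t ht
  have hlt : ∀ β : Iio α, β.1 < κ := fun β => lt_trans β.2 hα
  let f : Iio α → predSet T t := fun β =>
    ⟨p β, ⟨β, hlt β, hp β β.2⟩, (h.treeLT_iff hα (hlt β) (hp β β.2) ht).2 ⟨β.2, htp β β.2⟩⟩
  have hinj : Injective f := fun β γ hβγ => by
    have heq : p β = p γ := congrArg Subtype.val hβγ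
    exact Subtype.ext (h.level_unique (hlt β) (hlt γ) (hp β β.2) (heq ▸ hp γ γ.2))
  have hsurj : Surjective f := by
    rintro ⟨s, ⟨β, hβ, hs⟩, hst⟩
    obtain ⟨hβα, hts⟩ := (h.treeLT_iff hα hβ hs ht).1 hst
    exact ⟨⟨β, hβα⟩, Subtype.ext ((h.isMadFamily β hβ).eq_of_infinite_inter (hp β hβα) hs
      ((htp β hβα).infinite_inter_of_infinite hts hti))⟩
  have hrel : ∀ {β γ : Iio α}, predRel T t (f β) (f γ) ↔ β < γ := by
    intro β γ
    refine (h.treeLT_iff (hlt γ) (hlt β) (hp β β.2) (hp γ γ.2)).trans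
      ⟨fun hβγ => hβγ.1, fun hβγ => ⟨hβγ, ?_⟩⟩
    obtain ⟨r, hr, hγr, -⟩ := h.refines γ (hlt γ) β hβγ _ (hp γ γ.2)
    rwa [(h.isMadFamily β (hlt β)).eq_of_infinite_inter (hp β β.2) hr
      ((htp β β.2).infinite_inter_of_infinite ((htp γ γ.2).trans hγr) hti)]
  let e : ((· < ·) : α.ToType → α.ToType → Prop) ≃r predRel T t :=
    (Ordinal.ToType.mk (o := α)).symm.toRelIsoLT.trans ⟨Equiv.ofBijective f ⟨hinj, hsurj⟩, hrel⟩
  have hwo : IsWellOrder (predSet T t) (predRel T t) := e.symm.toRelEmbedding.isWellOrder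
  exact ⟨hwo, by rw [← Ordinal.type_toType α]; exact (Ordinal.type_eq.2 ⟨e⟩).symm⟩

theorem isTreePiBase (h : IsBaseMatrix κ B) : IsTreePiBase {t | ∃ α < κ, t ∈ B α} where
  infinite_mem := fun t ⟨α, hα, ht⟩ => (h.isMadFamily α hα).1 t ht
  tree := fun _ ⟨_, hα, ht⟩ => (h.hasPredOrderType hα ht).1
  levels ξ := by
    rintro ⟨t, ⟨α, hα, ht⟩, hwo, hξ⟩
    obtain ⟨_, hα'⟩ := h.hasPredOrderType hα ht
    obtain rfl : ξ = α := hξ.symm.trans hα'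
    have hlevel : TreeLevel {t | ∃ α < κ, t ∈ B α} ξ = B ξ := by
      ext s
      constructor
      · rintro ⟨⟨β, hβ, hs⟩, hwo', hs'⟩
        obtain ⟨_, hβ'⟩ := h.hasPredOrderType hβ hs
        rw [← hs', hβ']
        exact hs
      · exact fun hs => ⟨⟨_, hα, hs⟩, h.hasPredOrderType hα hs⟩
    rw [hlevel]
    exact ⟨h.infinite _ hα, h.isMadFamily _ hα⟩
  pibase X hX := by
    obtain ⟨α, hα, t, ht, htX⟩ := h.exists_almostSubset X hX
    exact ⟨t, ⟨α, hα, ht⟩, htX⟩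

end IsBaseMatrix

/-- The theorem of Balcar, Pelant and Simon: there exists a tree π-base for `ω*`. -/
theorem statement19 : ∃ T : Set (Set ℕ), IsTreePiBase T := by
  obtain ⟨κ, B, h⟩ := exists_isBaseMatrix
  exact ⟨_, h.isTreePiBase⟩
end
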